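/- Let v be a monotone XOS function on finite A given as v(S) = max_j f_j(S) for nonnegative additive f_j, with v(∅)=0 and max_{i∈A} v({i}) = v₀. Let Z = v(T) where T ⊆ A is formed by including each element independently with probability 1/2. Then for any δ > 0: Pr[Z ≤ (1−δ)·E[Z]] ≤ exp(−δ²·E[Z]/(2v₀)). -/

import Mathlib

open Finset
open scoped Classical

/-- The generalized Kullback–Leibler integrand. -/
noncomputable def klTerm (x u : ℝ) : ℝ := x * Real.log x - x * Real.log u - x + u

theorem klTerm_ge_tangent {x u X U : ℝ} (hx : 0 < x) (hu : 0 < u) (hX : 0 < X) (hU : 0 < U) :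
    x * (Real.log X - Real.log U) - u * (X / U) + u ≤ klTerm x u := by
  have h := Real.log_le_sub_one_of_pos (show 0 < u * X / (x * U) by positivity)
  rw [Real.log_div (by positivity) (by positivity), Real.log_mul hu.ne' hX.ne',
    Real.log_mul hx.ne' hU.ne'] at h
  have h2 := mul_le_mul_of_nonneg_left h hx.le
  have h3 : x * (u * X / (x * U) - 1) = u * (X / U) - x := by field_simp
  unfold klTerm
  linarith

/-- The log-sum inequality. -/
theorem klTerm_sum_le {ι : Type*} (s : Finset ι) (hs : s.Nonempty) (x u : ι → ℝ)
    (hx : ∀ i, 0 < x i) (hu : ∀ i, 0 < u i) :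
    klTerm (∑ i ∈ s, x i) (∑ i ∈ s, u i) ≤ ∑ i ∈ s, klTerm (x i) (u i) := by
  have hX : 0 < ∑ i ∈ s, x i := sum_pos (fun i _ => hx i) hs
  have hU : 0 < ∑ i ∈ s, u i := sum_pos (fun i _ => hu i) hs
  have h := sum_le_sum (s := s) fun i _ => klTerm_ge_tangent (hx i) (hu i) hX hU
  rw [sum_add_distrib, sum_sub_distrib, ← sum_mul, ← sum_mul, mul_div_cancel₀ _ hU.ne'] at h
  refine le_trans (le_of_eq ?_) h
  unfold klTerm
  ring

theorem two_point_entropy_le {x u : ℝ} (hx : 0 < x) (hu : 0 < u) :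
    x * Real.log x + u * Real.log u - (x + u) * Real.log ((x + u) / 2) ≤ klTerm x u := by
  have h := Real.log_le_sub_one_of_pos (show 0 < u / ((x + u) / 2) by positivity)
  rw [Real.log_div hu.ne' (by positivity)] at h
  have h2 := mul_le_mul_of_nonneg_left h (add_pos hx hu).le
  have h3 : (x + u) * (u / ((x + u) / 2) - 1) = u - x := by field_simp; ring
  unfold klTerm
  linarith

/-- Modified logarithmic Sobolev inequality on the uniform cube of subsets of `s`. -/
theorem entropy_powerset_le {α : Type*} [DecidableEq α] (s : Finset α) (g : Finset α → ℝ)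
    (hg : ∀ t, 0 < g t) :
    ∑ t ∈ s.powerset, g t * Real.log (g t)
        - (∑ t ∈ s.powerset, g t) * Real.log ((∑ t ∈ s.powerset, g t) / 2 ^ s.card)
      ≤ ∑ t ∈ s.powerset, ∑ i ∈ t, klTerm (g t) (g (t.erase i)) := by
  induction s using Finset.induction_on generalizing g with
  | empty => simp
  | insert a s ha ih =>
    have h0 := ih g hg
    have h1 := ih (fun t => g (insert a t)) fun t => hg _
    have hne : s.powerset.Nonempty := powerset_nonempty s
    have hS0 : 0 < ∑ t ∈ s.powerset, g t := sum_pos (fun t _ => hg t) hne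
    have hS1 : 0 < ∑ t ∈ s.powerset, g (insert a t) := sum_pos (fun t _ => hg _) hne
    have hsum := klTerm_sum_le s.powerset hne (fun t => g (insert a t)) g (fun t => hg _) hg
    have htwo := two_point_entropy_le hS1 hS0
    have hsplit : ∑ t ∈ s.powerset, ∑ i ∈ insert a t,
          klTerm (g (insert a t)) (g ((insert a t).erase i))
        = ∑ t ∈ s.powerset, klTerm (g (insert a t)) (g t)
          + ∑ t ∈ s.powerset, ∑ i ∈ t, klTerm (g (insert a t)) (g (insert a (t.erase i))) := by
      rw [← sum_add_distrib]
      refine sum_congr rfl fun t ht => ?_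
      have hat : a ∉ t := fun h => ha (mem_powerset.1 ht h)
      rw [sum_insert hat, erase_insert hat]
      congr 1
      refine sum_congr rfl fun i hi => ?_
      rw [erase_insert_of_ne (ne_of_mem_of_not_mem hi hat).symm]
    rw [sum_powerset_insert ha, sum_powerset_insert ha, sum_powerset_insert ha, hsplit,
      card_insert_of_notMem ha]
    generalize ∑ t ∈ s.powerset, g t = S0 at *
    generalize ∑ t ∈ s.powerset, g (insert a t) = S1 at *
    have hN : (0 : ℝ) < 2 ^ s.card := by positivity
    rw [Real.log_div hS0.ne' hN.ne'] at h0
    rw [Real.log_div hS1.ne' hN.ne'] at h1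
    have e : (S0 + S1) / 2 ^ (s.card + 1) = (S1 + S0) / 2 / 2 ^ s.card := by
      rw [pow_succ]; field_simp; ring
    rw [e, Real.log_div (by positivity) hN.ne']
    linarith

/-- Herbst-type differential inequality for the Laplace transform of a self-bounding function. -/
theorem self_bounding_laplace_deriv {α : Type*} [DecidableEq α] (s : Finset α)
    (g : Finset α → ℝ) (hmono : ∀ t, ∀ i ∈ t, g (t.erase i) ≤ g t)
    (hle : ∀ t, ∀ i ∈ t, g t - g (t.erase i) ≤ 1)
    (hsum : ∀ t, ∑ i ∈ t, (g t - g (t.erase i)) ≤ g t) (l : ℝ) :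
    (Real.exp l - 1) * ∑ t ∈ s.powerset, -g t * Real.exp (-g t * l)
      ≤ (∑ t ∈ s.powerset, Real.exp (-g t * l))
        * Real.log ((∑ t ∈ s.powerset, Real.exp (-g t * l)) / 2 ^ s.card) := by
  have h := entropy_powerset_le s (fun t => Real.exp (-g t * l)) fun t => Real.exp_pos _
  simp only [Real.log_exp] at h
  have hterm : ∀ t, ∑ i ∈ t, klTerm (Real.exp (-g t * l)) (Real.exp (-g (t.erase i) * l))
      ≤ (Real.exp l - 1 - l) * (g t * Real.exp (-g t * l)) := by
    intro t
    have hφ : 0 ≤ Real.exp l - 1 - l := by linarith [Real.add_one_le_exp l]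
    have hi : ∀ i ∈ t, klTerm (Real.exp (-g t * l)) (Real.exp (-g (t.erase i) * l))
        ≤ (Real.exp l - 1 - l) * Real.exp (-g t * l) * (g t - g (t.erase i)) := by
      intro i hi
      set d := g t - g (t.erase i) with hd
      have hd0 : 0 ≤ d := sub_nonneg.2 (hmono t i hi)
      have hd1 : d ≤ 1 := hle t i hi
      have hconv := convexOn_exp.2 (Set.mem_univ 0) (Set.mem_univ l) (sub_nonneg.2 hd1) hd0
        (sub_add_cancel 1 d)
      simp only [smul_eq_mul, mul_zero, zero_add, Real.exp_zero, mul_one] at hconv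
      have he : Real.exp (-g (t.erase i) * l) = Real.exp (-g t * l) * Real.exp (d * l) := by
        rw [← Real.exp_add, hd]; ring_nf
      unfold klTerm
      rw [Real.log_exp, Real.log_exp, he]
      have hm := mul_le_mul_of_nonneg_left hconv (Real.exp_pos (-g t * l)).le
      rw [show g (t.erase i) = g t - d by rw [hd]; ring]
      nlinarith [hm]
    refine (sum_le_sum hi).trans ?_
    rw [← mul_sum]
    refine (mul_le_mul_of_nonneg_left (hsum t)
      (mul_nonneg hφ (Real.exp_pos _).le)).trans (le_of_eq (by ring))
  have h2 := h.trans (sum_le_sum fun t _ => hterm t)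
  rw [← mul_sum] at h2
  have e1 : ∑ t ∈ s.powerset, Real.exp (-g t * l) * (-g t * l)
      = -(l * ∑ t ∈ s.powerset, g t * Real.exp (-g t * l)) := by
    rw [mul_sum, ← sum_neg_distrib]
    exact sum_congr rfl fun t _ => by ring
  have e2 : ∑ t ∈ s.powerset, -g t * Real.exp (-g t * l)
      = -∑ t ∈ s.powerset, g t * Real.exp (-g t * l) := by
    rw [← sum_neg_distrib]
    exact sum_congr rfl fun t _ => by ring
  rw [e1] at h2
  rw [e2]
  linarith

/-- If `H 0 = 0` and `(exp l - 1) * H' l ≤ H l` for `l > 0`, then `H l ≤ (1 - exp (-l)) * H' 0`. -/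
theorem le_of_exp_sub_one_mul_deriv_le {H H' : ℝ → ℝ} (hH : ∀ l, HasDerivAt H (H' l) l)
    (h0 : H 0 = 0) (hineq : ∀ l, 0 < l → (Real.exp l - 1) * H' l ≤ H l) {l : ℝ} (hl : 0 < l) :
    H l ≤ (1 - Real.exp (-l)) * H' 0 := by
  have hD : ∀ x : ℝ, HasDerivAt (fun x => 1 - Real.exp (-x)) (Real.exp (-x)) x := fun x => by
    simpa using ((hasDerivAt_neg x).exp).const_sub 1
  have hpos : ∀ x : ℝ, 0 < x → 0 < 1 - Real.exp (-x) := fun x hx =>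
    sub_pos.2 (Real.exp_lt_one_iff.2 (neg_lt_zero.2 hx))
  have hq : ∀ x : ℝ, 0 < x → HasDerivAt (fun x => H x / (1 - Real.exp (-x)))
      ((H' x * (1 - Real.exp (-x)) - H x * Real.exp (-x)) / (1 - Real.exp (-x)) ^ 2) x :=
    fun x hx => (hH x).div (hD x) (hpos x hx).ne'
  have hanti : AntitoneOn (fun x => H x / (1 - Real.exp (-x))) (Set.Ioi 0) := by
    refine antitoneOn_of_deriv_nonpos (convex_Ioi 0)
      (fun x hx => (hq x hx).continuousAt.continuousWithinAt)
      (fun x hx => (hq x (interior_subset hx)).differentiableAt.differentiableWithinAt)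
      fun x hx => ?_
    have hx0 : 0 < x := interior_subset hx
    rw [(hq x hx0).deriv]
    refine div_nonpos_of_nonpos_of_nonneg ?_ (sq_nonneg _)
    have h := mul_le_mul_of_nonneg_right (hineq x hx0) (Real.exp_pos (-x)).le
    have e : Real.exp x * Real.exp (-x) = 1 := by rw [← Real.exp_add]; simp
    linear_combination h - H' x * e
  have hlim : Filter.Tendsto (fun x => H x / (1 - Real.exp (-x))) (nhdsWithin 0 (Set.Ioi 0))
      (nhds (H' 0)) := by
    have t1 := (hH 0).tendsto_slope_zero_right
    have t2 := (hD 0).tendsto_slope_zero_right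
    simp only [zero_add, h0, sub_zero, neg_zero, Real.exp_zero, sub_self, smul_eq_mul] at t1 t2
    have t3 := t1.div t2 one_ne_zero
    rw [div_one] at t3
    refine t3.congr' ?_
    filter_upwards [self_mem_nhdsWithin] with x hx
    have hx0 : (0 : ℝ) < x := hx
    exact mul_div_mul_left _ _ (inv_ne_zero hx0.ne')
  have hle : H l / (1 - Real.exp (-l)) ≤ H' 0 := by
    refine ge_of_tendsto hlim ?_
    filter_upwards [Ioc_mem_nhdsGT hl] with x hx
    exact hanti hx.1 hl hx.2
  rw [div_le_iff₀ (hpos l hl)] at hle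
  linarith

/-- Laplace transform bound for a self-bounding function of a uniformly random subset of `s`. -/
theorem self_bounding_laplace_le {α : Type*} [DecidableEq α] (s : Finset α)
    (g : Finset α → ℝ) (hmono : ∀ t, ∀ i ∈ t, g (t.erase i) ≤ g t)
    (hle : ∀ t, ∀ i ∈ t, g t - g (t.erase i) ≤ 1)
    (hsum : ∀ t, ∑ i ∈ t, (g t - g (t.erase i)) ≤ g t) {l : ℝ} (hl : 0 < l) :
    (∑ t ∈ s.powerset, Real.exp (-g t * l)) / 2 ^ s.card
      ≤ Real.exp (-(1 - Real.exp (-l)) * ((∑ t ∈ s.powerset, g t) / 2 ^ s.card)) := by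
  have hF : ∀ l, 0 < ∑ t ∈ s.powerset, Real.exp (-g t * l) := fun l =>
    sum_pos (fun t _ => Real.exp_pos _) (powerset_nonempty s)
  have hN : (0 : ℝ) < 2 ^ s.card := by positivity
  have hderivF : ∀ l, HasDerivAt (fun l => ∑ t ∈ s.powerset, Real.exp (-g t * l))
      (∑ t ∈ s.powerset, -g t * Real.exp (-g t * l)) l := fun l => by
    refine HasDerivAt.fun_sum fun t _ => ?_
    have h := ((hasDerivAt_id l).const_mul (-g t)).exp
    simpa [mul_comm] using h
  have hderiv : ∀ l, HasDerivAt
      (fun l => Real.log ((∑ t ∈ s.powerset, Real.exp (-g t * l)) / 2 ^ s.card))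
      ((∑ t ∈ s.powerset, -g t * Real.exp (-g t * l))
        / ∑ t ∈ s.powerset, Real.exp (-g t * l)) l := fun l => by
    have h := ((hderivF l).div_const (2 ^ s.card)).log (div_pos (hF l) hN).ne'
    rwa [div_div_div_cancel_right₀ hN.ne'] at h
  have key := le_of_exp_sub_one_mul_deriv_le hderiv (by simp)
    (fun l _ => by
      rw [← mul_div_assoc, div_le_iff₀ (hF l), mul_comm (Real.log _)]
      exact self_bounding_laplace_deriv s g hmono hle hsum l) hl
  rw [← Real.log_le_iff_le_exp (div_pos (hF l) hN)]
  refine key.trans (le_of_eq ?_)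
  simp only [mul_zero, Real.exp_zero, mul_one, sum_neg_distrib, sum_const, card_powerset,
    nsmul_eq_mul]
  push_cast
  ring

theorem exp_neg_le_quadratic {l : ℝ} (hl : 0 ≤ l) : Real.exp (-l) ≤ 1 - l + l ^ 2 / 2 := by
  have h := Real.quadratic_le_exp_of_nonneg hl
  rw [Real.exp_neg]
  refine inv_le_of_inv_le₀ (by nlinarith [sq_nonneg (l - 1)]) (le_trans ?_ h)
  rw [inv_le_iff_one_le_mul₀ (by nlinarith [sq_nonneg (l - 1)])]
  nlinarith [sq_nonneg (l ^ 2)]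

/-- Lower-tail bound for a self-bounding function of a uniformly random subset of `s`. -/
theorem self_bounding_lower_tail {α : Type*} [DecidableEq α] (s : Finset α)
    (g : Finset α → ℝ) (hg : ∀ t, 0 ≤ g t) (hmono : ∀ t, ∀ i ∈ t, g (t.erase i) ≤ g t)
    (hle : ∀ t, ∀ i ∈ t, g t - g (t.erase i) ≤ 1)
    (hsum : ∀ t, ∑ i ∈ t, (g t - g (t.erase i)) ≤ g t) {δ : ℝ} (hδ : 0 < δ) (M : ℝ)
    (hM : M = (∑ t ∈ s.powerset, g t) / 2 ^ s.card) :
    ((s.powerset.filter (fun t => g t ≤ (1 - δ) * M)).card : ℝ) / 2 ^ s.card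
      ≤ Real.exp (-(δ ^ 2 * M / 2)) := by
  have hM0 : 0 ≤ M := by
    rw [hM]; exact div_nonneg (sum_nonneg fun t _ => hg t) (by positivity)
  have hlap := self_bounding_laplace_le s g hmono hle hsum hδ
  rw [← hM] at hlap
  have hmarkov : ((s.powerset.filter (fun t => g t ≤ (1 - δ) * M)).card : ℝ)
      ≤ Real.exp ((1 - δ) * M * δ) * ∑ t ∈ s.powerset, Real.exp (-g t * δ) := by
    rw [card_eq_sum_ones, Nat.cast_sum, mul_sum, sum_filter]
    refine sum_le_sum fun t _ => ?_
    rw [← Real.exp_add]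
    split_ifs with h
    · rw [Nat.cast_one]
      refine Real.one_le_exp ?_
      nlinarith
    · exact (Real.exp_pos _).le
  calc _ ≤ Real.exp ((1 - δ) * M * δ) * (∑ t ∈ s.powerset, Real.exp (-g t * δ)) / 2 ^ s.card := by
        gcongr
    _ ≤ Real.exp ((1 - δ) * M * δ) * Real.exp (-(1 - Real.exp (-δ)) * M) := by
        rw [mul_div_assoc]; gcongr
    _ ≤ _ := by
        rw [← Real.exp_add]
        refine Real.exp_le_exp.2 ?_
        have := mul_le_mul_of_nonneg_right (exp_neg_le_quadratic hδ.le) hM0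
        linarith

/-- Lower-tail concentration for XOS valuations: if `v` is a maximum of
nonnegative additive functions, `v₀` is the largest singleton value, and
`Z = v(T)` for a uniformly random subset `T` (each element included
independently with probability 1/2) with expectation `μ`, then for any
`δ > 0`, `Pr[Z ≤ (1−δ)·μ] ≤ exp(−δ²·μ/(2·v₀))`. -/
theorem xos_lower_tail_concentration {A : Type*} [Fintype A] [DecidableEq A]
    (m : ℕ) (hm : 0 < m)
    (f : Fin m → A → ℝ) (hf : ∀ (j : Fin m) (i : A), 0 ≤ f j i)
    (v : Finset A → ℝ) (hempty : v ∅ = 0)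
    (hv : ∀ S : Finset A,
      v S = (Finset.univ : Finset (Fin m)).sup'
        ⟨⟨0, hm⟩, Finset.mem_univ _⟩ (fun j => ∑ i ∈ S, f j i))
    (v0 : ℝ) (hv0 : IsGreatest {y : ℝ | ∃ i : A, v {i} = y} v0)
    (μ : ℝ)
    (hμ : μ = (∑ T ∈ (Finset.univ : Finset A).powerset, v T) / 2 ^ (Fintype.card A))
    (δ : ℝ) (hδ : 0 < δ) :
    (((Finset.univ : Finset A).powerset.filter
        (fun T => v T ≤ (1 - δ) * μ)).card : ℝ) / 2 ^ (Fintype.card A)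
      ≤ Real.exp (-(δ ^ 2 * μ / (2 * v0))) := by
  have hcard : Fintype.card A = (Finset.univ : Finset A).card := rfl
  have hne : (Finset.univ : Finset (Fin m)).Nonempty := ⟨⟨0, hm⟩, Finset.mem_univ _⟩
  have hge : ∀ (S : Finset A) (j : Fin m), ∑ i ∈ S, f j i ≤ v S := fun S j => by
    rw [hv S]
    exact le_sup' (fun j => ∑ i ∈ S, f j i) (mem_univ j)
  have hex : ∀ S : Finset A, ∃ j, v S = ∑ i ∈ S, f j i := fun S => by
    obtain ⟨j, -, hj⟩ := exists_mem_eq_sup' hne (fun j => ∑ i ∈ S, f j i)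
    exact ⟨j, (hv S).trans hj⟩
  have hnonneg : ∀ S, 0 ≤ v S := fun S =>
    (sum_nonneg fun i _ => hf ⟨0, hm⟩ i).trans (hge S ⟨0, hm⟩)
  have hfv0 : ∀ j i, f j i ≤ v0 := fun j i => by
    simpa using (hge {i} j).trans (hv0.2 ⟨i, rfl⟩)
  have hv0_nonneg : 0 ≤ v0 := by
    obtain ⟨i, hi⟩ := hv0.1
    exact hi ▸ hnonneg {i}
  have hmono : ∀ t : Finset A, ∀ i ∈ t, v (t.erase i) ≤ v t := fun t i _ => by
    obtain ⟨j, hj⟩ := hex (t.erase i)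
    rw [hj]
    exact (sum_le_sum_of_subset_of_nonneg (erase_subset i t) fun k _ _ => hf j k).trans (hge t j)
  have hdiff : ∀ (t : Finset A) (j : Fin m), v t = ∑ i ∈ t, f j i →
      ∀ i ∈ t, v t - v (t.erase i) ≤ f j i := fun t j hj i hi => by
    have h1 := hge (t.erase i) j
    have h2 := add_sum_erase t (f j) hi
    linarith
  rcases hv0_nonneg.eq_or_lt with h | hpos
  · rw [← h, mul_zero, div_zero, neg_zero, Real.exp_zero, div_le_one (by positivity)]
    have h := card_filter_le (Finset.univ : Finset A).powerset (fun T => v T ≤ (1 - δ) * μ)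
    rw [card_powerset] at h
    exact_mod_cast h
  · have key := self_bounding_lower_tail (Finset.univ : Finset A) (fun t => v t / v0)
      (fun t => div_nonneg (hnonneg t) hpos.le)
      (fun t i hi => div_le_div_of_nonneg_right (hmono t i hi) hpos.le)
      (fun t i hi => by
        obtain ⟨j, hj⟩ := hex t
        rw [← sub_div, div_le_one hpos]
        exact (hdiff t j hj i hi).trans (hfv0 j i))
      (fun t => by
        obtain ⟨j, hj⟩ := hex t
        simp only [← sub_div]
        rw [← sum_div]
        refine div_le_div_of_nonneg_right ?_ hpos.le
        exact (sum_le_sum (hdiff t j hj)).trans hj.ge)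
      hδ (μ / v0) (by rw [hμ, ← sum_div, hcard]; ring)
    have hiff : ∀ T, v T / v0 ≤ (1 - δ) * (μ / v0) ↔ v T ≤ (1 - δ) * μ := fun T => by
      rw [← mul_div_assoc, div_le_div_iff_of_pos_right hpos]
    simp only [hiff] at key
    rw [hcard]
    refine le_of_le_of_eq (le_of_eq_of_le ?_ key) ?_
    · congr!
    · congr 2
      field_simp
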